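/- For every λ ∈ 𝔫*, the map ψ ↦ Ind_{S̄_λ}^G(ψ) is a bijection from the set Irr(S̄_λ, Ind_{L̄_λ}^{S̄_λ}(θ_λ)) of irreducible constituents of Ind_{L̄_λ}^{S̄_λ}(θ_λ) onto the set Irr(G, ξ_λ) of irreducible constituents of ξ_λ. -/

import Mathlib

open scoped Classical BigOperators ComplexOrder

set_option linter.unusedSectionVars false
set_option linter.unusedVariables false

noncomputable section

namespace IterChar

/-! ### Generic notions for finite groups: inner product, induction, characters -/

/-- The standard inner product `⟨f,h⟩_G = |G|⁻¹ ∑_{x ∈ G} f x * conj (h x)`. -/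
def innerG (G : Type) [Group G] (f h : G → ℂ) : ℂ :=
  (Nat.card G : ℂ)⁻¹ * ∑ᶠ x : G, f x * (starRingEnd ℂ) (h x)

/-- Induction of a function from a subgroup, via the Frobenius formula. -/
def indFun {G : Type} [Group G] (H : Subgroup G) (ψ : ↥H → ℂ) : G → ℂ :=
  fun g => (Nat.card ↥H : ℂ)⁻¹ *
    ∑ᶠ x : G, if h : x * g * x⁻¹ ∈ H then ψ ⟨x * g * x⁻¹, h⟩ else 0

/-- A function `G → ℂ` is a character if it is the trace character of some
finite-dimensional complex representation. -/
def IsCharacter (G : Type) [Group G] (f : G → ℂ) : Prop :=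
  ∃ V : FDRep ℂ G, f = FDRep.character V

/-- The set of irreducible characters of `G`: characters of norm one. -/
def Irr (G : Type) [Group G] : Set (G → ℂ) :=
  {f | IsCharacter G f ∧ innerG G f f = 1}

/-- The set of irreducible constituents of `χ`: irreducible characters with
`⟨χ, ψ⟩_G > 0` (using the complex partial order). -/
def IrrConstituents (G : Type) [Group G] (χ : G → ℂ) : Set (G → ℂ) :=
  {f | f ∈ Irr G ∧ 0 < innerG G χ f}

/-! ### Algebra groups -/

variable {F : Type} [Field F] [Fintype F] {R : Type} [Ring R] [Algebra F R] [Fintype R]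

/-- `J` is a nilpotent (non-unital) subalgebra: all products of some fixed length vanish. -/
def IsNil (J : NonUnitalSubalgebra F R) : Prop :=
  ∃ N : ℕ, ∀ l : List R, (∀ x ∈ l, x ∈ J) → l.length = N → l.prod = 0

/-- The algebra group `G = 1 + J` of a (nilpotent) subalgebra `J ⊆ R`, realized as the
subgroup of units `u` of `R` with `u - 1 ∈ J` (and `u⁻¹ - 1 ∈ J`, which is automatic
when `J` is nilpotent). -/
def algGroup (F : Type) [Field F] [Fintype F] (R : Type) [Ring R] [Algebra F R] [Fintype R]
    (J : NonUnitalSubalgebra F R) : Subgroup Rˣ where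
  carrier := {u : Rˣ | ((u : R) - 1 ∈ J) ∧ (((u⁻¹ : Rˣ) : R) - 1 ∈ J)}
  one_mem' := by
    constructor <;> · simp only [Units.val_one, inv_one, sub_self]; exact J.zero_mem
  mul_mem' := by
    rintro u v ⟨hu1, hu2⟩ ⟨hv1, hv2⟩
    constructor
    · have h : ((u * v : Rˣ) : R) - 1 =
          ((u : R) - 1) * ((v : R) - 1) + ((u : R) - 1) + ((v : R) - 1) := by
        push_cast; noncomm_ring
      rw [h]
      exact add_mem (add_mem (mul_mem hu1 hv1) hu1) hv1
    · have h : (((u * v)⁻¹ : Rˣ) : R) - 1 =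
          (((v⁻¹ : Rˣ) : R) - 1) * (((u⁻¹ : Rˣ) : R) - 1) +
            (((v⁻¹ : Rˣ) : R) - 1) + (((u⁻¹ : Rˣ) : R) - 1) := by
        rw [mul_inv_rev]; push_cast; noncomm_ring
      rw [h]
      exact add_mem (add_mem (mul_mem hv2 hu2) hv2) hu2
  inv_mem' := by
    rintro u ⟨h1, h2⟩
    exact ⟨h2, by simpa using h1⟩

theorem mem_algGroup {J : NonUnitalSubalgebra F R} {u : Rˣ} :
    u ∈ algGroup F R J ↔ ((u : R) - 1 ∈ J) ∧ (((u⁻¹ : Rˣ) : R) - 1 ∈ J) :=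
  Iff.rfl

/-- The element `X ∈ J` such that `g = 1 + X`. -/
def gElt {J : NonUnitalSubalgebra F R} (g : ↥(algGroup F R J)) : ↥J :=
  ⟨((g : Rˣ) : R) - 1, g.2.1⟩

/-- The function `θ_λ(1+X) = θ(λ(X))` on the algebra group `1 + J`. -/
def thetaFn (θ : AddChar F ℂ) (J : NonUnitalSubalgebra F R) (lam : ↥J →ₗ[F] F) :
    ↥(algGroup F R J) → ℂ :=
  fun g => θ (lam (gElt g))

/-- Left multiplication by the group element `g` as a linear endomorphism of `J`. -/
def lmulMap {J : NonUnitalSubalgebra F R} (g : ↥(algGroup F R J)) : ↥J →ₗ[F] ↥J where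
  toFun X := ⟨((g : Rˣ) : R) * (X : R), by
    have h : ((g : Rˣ) : R) * (X : R) = (((g : Rˣ) : R) - 1) * (X : R) + (X : R) := by
      noncomm_ring
    rw [h]; exact add_mem (mul_mem g.2.1 X.2) X.2⟩
  map_add' X Y := by ext; simp [mul_add]
  map_smul' c X := by ext; simp [mul_smul_comm]

/-- Right multiplication by the group element `g` as a linear endomorphism of `J`. -/
def rmulMap {J : NonUnitalSubalgebra F R} (g : ↥(algGroup F R J)) : ↥J →ₗ[F] ↥J where
  toFun X := ⟨(X : R) * ((g : Rˣ) : R), by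
    have h : (X : R) * ((g : Rˣ) : R) = (X : R) * (((g : Rˣ) : R) - 1) + (X : R) := by
      noncomm_ring
    rw [h]; exact add_mem (mul_mem X.2 g.2.1) X.2⟩
  map_add' X Y := by ext; simp [add_mul]
  map_smul' c X := by ext; simp [smul_mul_assoc]

/-- The left action of `G` on the dual space: `(gλ)(X) = λ(g⁻¹ X)`. -/
def leftAct {J : NonUnitalSubalgebra F R} (g : ↥(algGroup F R J)) (lam : ↥J →ₗ[F] F) :
    ↥J →ₗ[F] F :=
  lam.comp (lmulMap g⁻¹)

/-- The right action of `G` on the dual space: `(λg)(X) = λ(X g⁻¹)`. -/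
def rightAct {J : NonUnitalSubalgebra F R} (g : ↥(algGroup F R J)) (lam : ↥J →ₗ[F] F) :
    ↥J →ₗ[F] F :=
  lam.comp (rmulMap g⁻¹)

/-- The coadjoint action of `G` on the dual space: `λ^g(X) = λ(g X g⁻¹)`. -/
def coAct {J : NonUnitalSubalgebra F R} (g : ↥(algGroup F R J)) (lam : ↥J →ₗ[F] F) :
    ↥J →ₗ[F] F :=
  lam.comp ((lmulMap g).comp (rmulMap g⁻¹))

/-- The left orbit `Gλ`. -/
def leftOrbit (J : NonUnitalSubalgebra F R) (lam : ↥J →ₗ[F] F) : Set (↥J →ₗ[F] F) :=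
  Set.range fun g : ↥(algGroup F R J) => leftAct g lam

/-- The right orbit `λG`. -/
def rightOrbit (J : NonUnitalSubalgebra F R) (lam : ↥J →ₗ[F] F) : Set (↥J →ₗ[F] F) :=
  Set.range fun g : ↥(algGroup F R J) => rightAct g lam

/-- The two-sided orbit `GλG`. -/
def twoOrbit (J : NonUnitalSubalgebra F R) (lam : ↥J →ₗ[F] F) : Set (↥J →ₗ[F] F) :=
  {mu | ∃ g h : ↥(algGroup F R J), mu = leftAct g (rightAct h lam)}

/-- The coadjoint orbit `λ^G`. -/
def coOrbit (J : NonUnitalSubalgebra F R) (lam : ↥J →ₗ[F] F) : Set (↥J →ₗ[F] F) :=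
  Set.range fun g : ↥(algGroup F R J) => coAct g lam

/-- The right orbit of `λ` under a subgroup `H` of the algebra group. -/
def rightOrbitUnder (J : NonUnitalSubalgebra F R) (H : Subgroup ↥(algGroup F R J))
    (lam : ↥J →ₗ[F] F) : Set (↥J →ₗ[F] F) :=
  {mu | ∃ s ∈ H, mu = rightAct s lam}

/-- The Kirillov function `ψ_λ = |λ^G|^{-1/2} ∑_{μ ∈ λ^G} θ_μ`. -/
def kirillov (θ : AddChar F ℂ) (J : NonUnitalSubalgebra F R) (lam : ↥J →ₗ[F] F) :
    ↥(algGroup F R J) → ℂ :=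
  fun g => ((Real.sqrt (Nat.card ↥(coOrbit J lam)) : ℂ))⁻¹ *
    ∑ᶠ mu ∈ coOrbit J lam, thetaFn θ J mu g

/-- The supercharacter `χ_λ = (|Gλ|/|GλG|) ∑_{μ ∈ GλG} θ_μ`. -/
def superchar (θ : AddChar F ℂ) (J : NonUnitalSubalgebra F R) (lam : ↥J →ₗ[F] F) :
    ↥(algGroup F R J) → ℂ :=
  fun g => ((Nat.card ↥(leftOrbit J lam) : ℂ) / (Nat.card ↥(twoOrbit J lam) : ℂ)) *
    ∑ᶠ mu ∈ twoOrbit J lam, thetaFn θ J mu g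

/-! ### The subalgebras `𝔩_λ`, `𝔰_λ` and their iterates -/

/-- The extension of `λ : J → F` by zero to all of `R`. -/
def lamE (J : NonUnitalSubalgebra F R) (lam : ↥J →ₗ[F] F) (x : R) : F :=
  if h : x ∈ J then lam ⟨x, h⟩ else 0

theorem lamE_apply (J : NonUnitalSubalgebra F R) (lam : ↥J →ₗ[F] F) {x : R} (hx : x ∈ J) :
    lamE J lam x = lam ⟨x, hx⟩ := dif_pos hx

theorem lamE_zero (J : NonUnitalSubalgebra F R) (lam : ↥J →ₗ[F] F) : lamE J lam 0 = 0 := by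
  rw [lamE_apply J lam J.zero_mem]
  have h : (⟨(0 : R), J.zero_mem⟩ : ↥J) = 0 := Subtype.ext rfl
  rw [h, map_zero]

theorem lamE_add (J : NonUnitalSubalgebra F R) (lam : ↥J →ₗ[F] F) {x y : R}
    (hx : x ∈ J) (hy : y ∈ J) : lamE J lam (x + y) = lamE J lam x + lamE J lam y := by
  rw [lamE, lamE, lamE, dif_pos (add_mem hx hy), dif_pos hx, dif_pos hy]
  have h : (⟨x + y, add_mem hx hy⟩ : ↥J) = ⟨x, hx⟩ + ⟨y, hy⟩ := Subtype.ext rfl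
  rw [h, map_add]

theorem lamE_smul (J : NonUnitalSubalgebra F R) (lam : ↥J →ₗ[F] F) (c : F) {x : R}
    (hx : x ∈ J) : lamE J lam (c • x) = c * lamE J lam x := by
  rw [lamE, lamE, dif_pos (SMulMemClass.smul_mem c hx), dif_pos hx]
  have h : (⟨c • x, SMulMemClass.smul_mem c hx⟩ : ↥J) = c • ⟨x, hx⟩ := Subtype.ext rfl
  rw [h, map_smul]
  rfl

/-- The left kernel `𝔩` of the bilinear form `(X,Y) ↦ λ(XY)` restricted to `s × s`. -/
def lStep (J : NonUnitalSubalgebra F R) (lam : ↥J →ₗ[F] F)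
    (s : NonUnitalSubalgebra F R) (hs : s ≤ J) : NonUnitalSubalgebra F R where
  carrier := {x | x ∈ s ∧ ∀ y ∈ s, lamE J lam (x * y) = 0}
  zero_mem' := ⟨zero_mem s, fun y _ => by rw [zero_mul, lamE_zero]⟩
  add_mem' := by
    rintro a b ⟨ha1, ha2⟩ ⟨hb1, hb2⟩
    refine ⟨add_mem ha1 hb1, fun y hy => ?_⟩
    rw [add_mul, lamE_add J lam (J.mul_mem (hs ha1) (hs hy)) (J.mul_mem (hs hb1) (hs hy)),
      ha2 y hy, hb2 y hy, add_zero]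
  smul_mem' := by
    rintro c a ⟨ha1, ha2⟩
    refine ⟨SMulMemClass.smul_mem c ha1, fun y hy => ?_⟩
    rw [smul_mul_assoc, lamE_smul J lam c (J.mul_mem (hs ha1) (hs hy)), ha2 y hy, mul_zero]
  mul_mem' := by
    rintro a b ⟨ha1, ha2⟩ ⟨hb1, hb2⟩
    refine ⟨mul_mem ha1 hb1, fun y hy => ?_⟩
    rw [mul_assoc]
    exact ha2 (b * y) (mul_mem hb1 hy)

theorem lStep_le (J : NonUnitalSubalgebra F R) (lam : ↥J →ₗ[F] F)
    (s : NonUnitalSubalgebra F R) (hs : s ≤ J) : lStep J lam s hs ≤ s :=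
  fun _ hx => hx.1

/-- The left kernel `𝔰` of the bilinear form `(X,Y) ↦ λ(XY)` restricted to `s × 𝔩`. -/
def sStep (J : NonUnitalSubalgebra F R) (lam : ↥J →ₗ[F] F)
    (s : NonUnitalSubalgebra F R) (hs : s ≤ J) : NonUnitalSubalgebra F R where
  carrier := {x | x ∈ s ∧ ∀ y ∈ lStep J lam s hs, lamE J lam (x * y) = 0}
  zero_mem' := ⟨zero_mem s, fun y _ => by rw [zero_mul, lamE_zero]⟩
  add_mem' := by
    rintro a b ⟨ha1, ha2⟩ ⟨hb1, hb2⟩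
    refine ⟨add_mem ha1 hb1, fun y hy => ?_⟩
    rw [add_mul, lamE_add J lam (J.mul_mem (hs ha1) (hs hy.1)) (J.mul_mem (hs hb1) (hs hy.1)),
      ha2 y hy, hb2 y hy, add_zero]
  smul_mem' := by
    rintro c a ⟨ha1, ha2⟩
    refine ⟨SMulMemClass.smul_mem c ha1, fun y hy => ?_⟩
    rw [smul_mul_assoc, lamE_smul J lam c (J.mul_mem (hs ha1) (hs hy.1)), ha2 y hy, mul_zero]
  mul_mem' := by
    rintro a b ⟨ha1, ha2⟩ ⟨hb1, hb2⟩
    refine ⟨mul_mem ha1 hb1, fun y hy => ?_⟩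
    rw [mul_assoc]
    refine ha2 (b * y) ⟨mul_mem hb1 hy.1, fun z hz => ?_⟩
    rw [mul_assoc]
    refine hb2 (y * z) ⟨mul_mem hy.1 hz, fun w hw => ?_⟩
    rw [mul_assoc]
    exact hy.2 (z * w) (mul_mem hz hw)

theorem sStep_le (J : NonUnitalSubalgebra F R) (lam : ↥J →ₗ[F] F)
    (s : NonUnitalSubalgebra F R) (hs : s ≤ J) : sStep J lam s hs ≤ s :=
  fun _ hx => hx.1

/-- `𝔩_λ`: the left kernel of `(X,Y) ↦ λ(XY)` on `J × J`. -/
def lone (J : NonUnitalSubalgebra F R) (lam : ↥J →ₗ[F] F) : NonUnitalSubalgebra F R :=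
  lStep J lam J le_rfl

/-- `𝔰_λ`: the left kernel of `(X,Y) ↦ λ(XY)` on `J × 𝔩_λ`. -/
def sone (J : NonUnitalSubalgebra F R) (lam : ↥J →ₗ[F] F) : NonUnitalSubalgebra F R :=
  sStep J lam J le_rfl

theorem lone_le (J : NonUnitalSubalgebra F R) (lam : ↥J →ₗ[F] F) : lone J lam ≤ J :=
  lStep_le J lam J le_rfl

theorem sone_le (J : NonUnitalSubalgebra F R) (lam : ↥J →ₗ[F] F) : sone J lam ≤ J :=
  sStep_le J lam J le_rfl

/-- `𝔨_λ = 𝔩_λ ∩ ker λ`. -/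
def kone (J : NonUnitalSubalgebra F R) (lam : ↥J →ₗ[F] F) : NonUnitalSubalgebra F R where
  carrier := {x | x ∈ lone J lam ∧ lamE J lam x = 0}
  zero_mem' := ⟨zero_mem _, lamE_zero J lam⟩
  add_mem' := by
    rintro a b ⟨ha1, ha2⟩ ⟨hb1, hb2⟩
    exact ⟨add_mem ha1 hb1, by
      rw [lamE_add J lam (lone_le J lam ha1) (lone_le J lam hb1), ha2, hb2, add_zero]⟩
  smul_mem' := by
    rintro c a ⟨ha1, ha2⟩
    exact ⟨SMulMemClass.smul_mem c ha1, by
      rw [lamE_smul J lam c (lone_le J lam ha1), ha2, mul_zero]⟩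
  mul_mem' := by
    rintro a b ⟨ha1, ha2⟩ ⟨hb1, hb2⟩
    exact ⟨mul_mem ha1 hb1, ha1.2 b (lone_le J lam hb1)⟩

theorem kone_le (J : NonUnitalSubalgebra F R) (lam : ↥J →ₗ[F] F) : kone J lam ≤ lone J lam :=
  fun _ hx => hx.1

/-- The descending chain `𝔰_λ^0 ⊇ 𝔰_λ^1 ⊇ ⋯` (bundled with the proof `𝔰_λ^i ≤ J`). -/
def sChainAux (J : NonUnitalSubalgebra F R) (lam : ↥J →ₗ[F] F) :
    ℕ → {s : NonUnitalSubalgebra F R // s ≤ J}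
  | 0 => ⟨J, le_rfl⟩
  | n + 1 =>
    ⟨sStep J lam (sChainAux J lam n).1 (sChainAux J lam n).2,
      le_trans (sStep_le J lam (sChainAux J lam n).1 (sChainAux J lam n).2)
        (sChainAux J lam n).2⟩

/-- `𝔰_λ^i`. -/
def sChain (J : NonUnitalSubalgebra F R) (lam : ↥J →ₗ[F] F) (i : ℕ) :
    NonUnitalSubalgebra F R :=
  (sChainAux J lam i).1

/-- `𝔩_λ^{i+1}`. -/
def lChain (J : NonUnitalSubalgebra F R) (lam : ↥J →ₗ[F] F) (i : ℕ) :
    NonUnitalSubalgebra F R :=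
  lStep J lam (sChainAux J lam i).1 (sChainAux J lam i).2

/-- The terminal element `𝔰̄_λ` of the descending chain; the chain has stabilized by
stage `|R|` since it is a weakly decreasing chain of subalgebras of the finite algebra. -/
def sbar (J : NonUnitalSubalgebra F R) (lam : ↥J →ₗ[F] F) : NonUnitalSubalgebra F R :=
  sChain J lam (Fintype.card R)

theorem sbar_le (J : NonUnitalSubalgebra F R) (lam : ↥J →ₗ[F] F) : sbar J lam ≤ J :=
  (sChainAux J lam (Fintype.card R)).2

/-- The terminal element `𝔩̄_λ` of the ascending chain. -/
def lbar (J : NonUnitalSubalgebra F R) (lam : ↥J →ₗ[F] F) : NonUnitalSubalgebra F R :=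
  lStep J lam (sbar J lam) (sbar_le J lam)

theorem lbar_le (J : NonUnitalSubalgebra F R) (lam : ↥J →ₗ[F] F) : lbar J lam ≤ J :=
  le_trans (lStep_le J lam _ _) (sbar_le J lam)

/-! ### Algebra subgroups of an algebra group -/

/-- The algebra subgroup `1 + k` of `1 + J`, as a subgroup of the ambient algebra group. -/
def algSubgroup (k J : NonUnitalSubalgebra F R) : Subgroup ↥(algGroup F R J) :=
  (algGroup F R k).subgroupOf (algGroup F R J)

/-- `L_λ = 1 + 𝔩_λ` as a subgroup of `G`. -/
def Lgrp (J : NonUnitalSubalgebra F R) (lam : ↥J →ₗ[F] F) : Subgroup ↥(algGroup F R J) :=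
  algSubgroup (lone J lam) J

/-- `S_λ = 1 + 𝔰_λ` as a subgroup of `G`. -/
def Sgrp (J : NonUnitalSubalgebra F R) (lam : ↥J →ₗ[F] F) : Subgroup ↥(algGroup F R J) :=
  algSubgroup (sone J lam) J

/-- `L̄_λ = 1 + 𝔩̄_λ` as a subgroup of `G`. -/
def Lbarg (J : NonUnitalSubalgebra F R) (lam : ↥J →ₗ[F] F) : Subgroup ↥(algGroup F R J) :=
  algSubgroup (lbar J lam) J

/-- `S̄_λ = 1 + 𝔰̄_λ` as a subgroup of `G`. -/
def Sbarg (J : NonUnitalSubalgebra F R) (lam : ↥J →ₗ[F] F) : Subgroup ↥(algGroup F R J) :=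
  algSubgroup (sbar J lam) J

/-- Passing from an element of the subgroup `1 + k ≤ 1 + J` to an element of the
algebra group `1 + k` in its own right. -/
def toAlg {k J : NonUnitalSubalgebra F R} (x : ↥(algSubgroup k J)) : ↥(algGroup F R k) :=
  ⟨((x : ↥(algGroup F R J)) : Rˣ), Subgroup.mem_subgroupOf.mp x.2⟩

/-- The linear inclusion of a smaller subalgebra. -/
def inclMap {s J : NonUnitalSubalgebra F R} (h : s ≤ J) : ↥s →ₗ[F] ↥J where
  toFun x := ⟨(x : R), h x.2⟩
  map_add' x y := rfl
  map_smul' c x := rfl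

/-- Restriction of a functional on `J` to a smaller subalgebra. -/
def resTo {s J : NonUnitalSubalgebra F R} (h : s ≤ J) (lam : ↥J →ₗ[F] F) : ↥s →ₗ[F] F :=
  lam.comp (inclMap h)

/-- The character `ξ_λ = Ind_{L̄_λ}^G (θ_λ)`. -/
def xi (θ : AddChar F ℂ) (J : NonUnitalSubalgebra F R) (lam : ↥J →ₗ[F] F) :
    ↥(algGroup F R J) → ℂ :=
  indFun (Lbarg J lam) (fun x => thetaFn θ J lam ↑x)

/-- The set `Ξ_λ = {g λ s g⁻¹ : g ∈ G, s ∈ S̄_λ}`. -/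
def Xi (J : NonUnitalSubalgebra F R) (lam : ↥J →ₗ[F] F) : Set (↥J →ₗ[F] F) :=
  {nu | ∃ g : ↥(algGroup F R J), ∃ s ∈ Sbarg J lam, nu = coAct g (rightAct s lam)}

/-! ### Normality of algebra subgroups coming from ideals -/

theorem conj_mem_aux (s a : NonUnitalSubalgebra F R)
    (hl : ∀ x ∈ s, ∀ y ∈ a, x * y ∈ a) (hr : ∀ y ∈ a, ∀ x ∈ s, y * x ∈ a)
    (u : Rˣ) (hu1 : (u : R) - 1 ∈ s) (hu2 : ((u⁻¹ : Rˣ) : R) - 1 ∈ s)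
    (x : Rˣ) (hx : (x : R) - 1 ∈ a) : ((u * x * u⁻¹ : Rˣ) : R) - 1 ∈ a := by
  have h1 : (u : R) * ((u⁻¹ : Rˣ) : R) = 1 := Units.mul_inv u
  have key : ((u * x * u⁻¹ : Rˣ) : R) - 1 =
      ((u : R) - 1) * ((x : R) - 1) * (((u⁻¹ : Rˣ) : R) - 1) +
        ((u : R) - 1) * ((x : R) - 1) + ((x : R) - 1) * (((u⁻¹ : Rˣ) : R) - 1) +
        ((x : R) - 1) := by
    push_cast
    calc (u : R) * (x : R) * ((u⁻¹ : Rˣ) : R) - 1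
        = (u : R) * (x : R) * ((u⁻¹ : Rˣ) : R) - (u : R) * ((u⁻¹ : Rˣ) : R) := by rw [h1]
      _ = _ := by noncomm_ring
  rw [key]
  exact add_mem (add_mem (add_mem (hr _ (hl _ hu1 _ hx) _ hu2) (hl _ hu1 _ hx))
    (hr _ hx _ hu2)) hx

theorem algSubgroup_normal (s a : NonUnitalSubalgebra F R)
    (hl : ∀ x ∈ s, ∀ y ∈ a, x * y ∈ a) (hr : ∀ y ∈ a, ∀ x ∈ s, y * x ∈ a) :
    ((algGroup F R a).subgroupOf (algGroup F R s)).Normal := by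
  constructor
  intro n hn g
  rw [Subgroup.mem_subgroupOf] at hn ⊢
  have hginv : ((g⁻¹ : ↥(algGroup F R s)) : Rˣ) = ((g : Rˣ))⁻¹ := rfl
  have hcoe : ((g * n * g⁻¹ : ↥(algGroup F R s)) : Rˣ) = (g : Rˣ) * (n : Rˣ) * ((g : Rˣ))⁻¹ := by
    push_cast [hginv]; rfl
  rw [mem_algGroup]
  constructor
  · rw [hcoe]
    exact conj_mem_aux s a hl hr (g : Rˣ) (g : ↥(algGroup F R s)).2.1 (g : ↥(algGroup F R s)).2.2
      (n : Rˣ) hn.1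
  · have hinv : (((g * n * g⁻¹ : ↥(algGroup F R s)) : Rˣ))⁻¹ =
        (g : Rˣ) * ((n : Rˣ))⁻¹ * ((g : Rˣ))⁻¹ := by
      rw [hcoe]; group
    rw [hinv]
    exact conj_mem_aux s a hl hr (g : Rˣ) (g : ↥(algGroup F R s)).2.1 (g : ↥(algGroup F R s)).2.2
      ((n : Rˣ))⁻¹ hn.2

theorem lone_mul_mem (J : NonUnitalSubalgebra F R) (lam : ↥J →ₗ[F] F)
    {y z : R} (hy : y ∈ lone J lam) (hz : z ∈ J) : y * z ∈ lone J lam := by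
  refine ⟨J.mul_mem (lone_le J lam hy) hz, fun w hw => ?_⟩
  rw [mul_assoc]
  exact hy.2 (z * w) (J.mul_mem hz hw)

theorem sone_mul_lone_mem (J : NonUnitalSubalgebra F R) (lam : ↥J →ₗ[F] F)
    {x y : R} (hx : x ∈ sone J lam) (hy : y ∈ lone J lam) : x * y ∈ lone J lam := by
  refine ⟨J.mul_mem (sone_le J lam hx) (lone_le J lam hy), fun w hw => ?_⟩
  rw [mul_assoc]
  exact hx.2 (y * w) (lone_mul_mem J lam hy hw)

theorem kone_ideal_left (J : NonUnitalSubalgebra F R) (lam : ↥J →ₗ[F] F) :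
    ∀ x ∈ sone J lam, ∀ y ∈ kone J lam, x * y ∈ kone J lam := by
  intro x hx y hy
  exact ⟨sone_mul_lone_mem J lam hx hy.1, hx.2 y hy.1⟩

theorem kone_ideal_right (J : NonUnitalSubalgebra F R) (lam : ↥J →ₗ[F] F) :
    ∀ y ∈ kone J lam, ∀ x ∈ sone J lam, y * x ∈ kone J lam := by
  intro y hy x hx
  exact ⟨lone_mul_mem J lam hy.1 (sone_le J lam hx), hy.1.2 x (sone_le J lam hx)⟩

/-- `K_λ = 1 + 𝔨_λ` as a (normal) subgroup of `S_λ = 1 + 𝔰_λ`. -/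
def KgrpIn (J : NonUnitalSubalgebra F R) (lam : ↥J →ₗ[F] F) :
    Subgroup ↥(algGroup F R (sone J lam)) :=
  (algGroup F R (kone J lam)).subgroupOf (algGroup F R (sone J lam))

instance KgrpIn_normal (J : NonUnitalSubalgebra F R) (lam : ↥J →ₗ[F] F) :
    (KgrpIn J lam).Normal :=
  algSubgroup_normal (sone J lam) (kone J lam) (kone_ideal_left J lam) (kone_ideal_right J lam)

/-- `L_λ = 1 + 𝔩_λ` as a (normal) subgroup of `S_λ = 1 + 𝔰_λ`. -/
def LgrpIn (J : NonUnitalSubalgebra F R) (lam : ↥J →ₗ[F] F) :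
    Subgroup ↥(algGroup F R (sone J lam)) :=
  (algGroup F R (lone J lam)).subgroupOf (algGroup F R (sone J lam))

instance LgrpIn_normal (J : NonUnitalSubalgebra F R) (lam : ↥J →ₗ[F] F) :
    (LgrpIn J lam).Normal :=
  algSubgroup_normal (sone J lam) (lone J lam)
    (fun x hx y hy => sone_mul_lone_mem J lam hx hy)
    (fun y hy x hx => lone_mul_mem J lam hy (sone_le J lam hx))

/-! ### Characters of representations of finite groups -/

section Characters

open Module

variable {G : Type} [Group G]

theorem innerG_eq_sum [Fintype G] (f h : G → ℂ) :
    innerG G f h = (Fintype.card G : ℂ)⁻¹ * ∑ x : G, f x * (starRingEnd ℂ) (h x) := by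
  rw [innerG, finsum_eq_sum_of_fintype, Nat.card_eq_fintype_card]

theorem innerG_conj_symm [Fintype G] (f h : G → ℂ) :
    (starRingEnd ℂ) (innerG G f h) = innerG G h f := by
  simp [innerG_eq_sum, mul_comm]

theorem innerG_sub_left [Fintype G] (f f' h : G → ℂ) :
    innerG G (f - f') h = innerG G f h - innerG G f' h := by
  simp [innerG_eq_sum, sub_mul, mul_sub]

theorem innerG_sub_right [Fintype G] (f h h' : G → ℂ) :
    innerG G f (h - h') = innerG G f h - innerG G f h' := by
  simp [innerG_eq_sum, mul_sub]

theorem innerG_self_eq [Fintype G] (f : G → ℂ) :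
    innerG G f f = (((Fintype.card G : ℝ)⁻¹ * ∑ x : G, ‖f x‖ ^ 2 : ℝ) : ℂ) := by
  simp [innerG_eq_sum, Complex.mul_conj, Complex.normSq_eq_norm_sq]

theorem innerG_self_nonneg [Fintype G] (f : G → ℂ) : 0 ≤ innerG G f f := by
  rw [innerG_self_eq, Complex.zero_le_real]
  positivity

theorem eq_zero_of_innerG_self [Fintype G] {f : G → ℂ} (h : innerG G f f = 0) : f = 0 := by
  rw [innerG_self_eq, Complex.ofReal_eq_zero, mul_eq_zero, inv_eq_zero] at h
  have h' := h.resolve_left (by simp)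
  rw [Finset.sum_eq_zero_iff_of_nonneg (fun _ _ => by positivity)] at h'
  funext x
  simpa using h' x (Finset.mem_univ x)

variable {V : Type} [AddCommGroup V] [Module ℂ V] [FiniteDimensional ℂ V]

theorem isCharacter_character (ρ : Representation ℂ G V) : IsCharacter G ρ.character :=
  ⟨FDRep.of ρ, rfl⟩

/-- The character value at an inverse is the complex conjugate of the character value. -/
theorem character_inv [Fintype G] (ρ : Representation ℂ G V) (g : G) :
    ρ.character g⁻¹ = (starRingEnd ℂ) (ρ.character g) := by
  let b := Module.finBasis ℂ V
  let A : G → Matrix (Fin (finrank ℂ V)) (Fin (finrank ℂ V)) ℂ :=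
    fun x => LinearMap.toMatrix b b (ρ x)
  have A_mul (x y : G) : A (x * y) = A x * A y := by
    simp only [A, map_mul]
    exact LinearMap.toMatrix_mul b _ _
  have A_one : A 1 = 1 := by simp [A, LinearMap.toMatrix_one]
  have A_trace (x : G) : ρ.character x = (A x).trace := LinearMap.trace_eq_matrix_trace ℂ b _
  let P := ∑ x, (A x).conjTranspose * A x
  have hP : P.PosDef := by
    have hsplit : P = (A 1).conjTranspose * A 1
        + ∑ x ∈ Finset.univ.erase 1, (A x).conjTranspose * A x :=
      (Finset.add_sum_erase _ (fun x => (A x).conjTranspose * A x) (Finset.mem_univ 1)).symm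
    rw [hsplit, A_one]
    refine Matrix.PosDef.add_posSemidef (by simpa using Matrix.PosDef.one) ?_
    exact Matrix.posSemidef_sum _ fun x _ => Matrix.posSemidef_conjTranspose_mul_self _
  have hinv : (A g).conjTranspose * P = P * A g⁻¹ := by
    have hsum : (A g).conjTranspose * P * A g = P := by
      simp only [P, Finset.mul_sum, Finset.sum_mul]
      refine (Finset.sum_congr rfl fun x _ => ?_).trans
        (Equiv.sum_comp (Equiv.mulRight g) fun x => (A x).conjTranspose * A x)
      simp [A_mul, Matrix.conjTranspose_mul, mul_assoc]
    calc (A g).conjTranspose * P = (A g).conjTranspose * P * (A g * A g⁻¹) := by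
          rw [← A_mul, mul_inv_cancel, A_one, mul_one]
      _ = P * A g⁻¹ := by rw [← mul_assoc, hsum]
  have hdet : IsUnit P.det := (Matrix.isUnit_iff_isUnit_det P).mp hP.isUnit
  rw [A_trace, A_trace, starRingEnd_apply, ← Matrix.trace_conjTranspose]
  calc (A g⁻¹).trace = (P * A g⁻¹ * P⁻¹).trace := by
        rw [Matrix.trace_mul_comm, ← mul_assoc, Matrix.nonsing_inv_mul _ hdet, one_mul]
    _ = (A g).conjTranspose.trace := by
        rw [← hinv, mul_assoc, Matrix.mul_nonsing_inv _ hdet, mul_one]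

theorem innerG_character [Fintype G] {W : Type} [AddCommGroup W] [Module ℂ W]
    [FiniteDimensional ℂ W] (σ : Representation ℂ G W) (ρ : Representation ℂ G V) :
    innerG G σ.character ρ.character = finrank ℂ (Representation.IntertwiningMap ρ σ) := by
  have : Invertible (Nat.card G : ℂ) := invertibleOfNonzero (by simp)
  rw [← Representation.card_inv_mul_sum_char_mul_char_eq_finrank, innerG_eq_sum,
    Nat.card_eq_fintype_card]
  simp only [character_inv]

/-- An idempotent commuting with a representation cuts out a subrepresentation. -/
theorem isCharacter_of_idempotent (ρ : Representation ℂ G V) (e : V →ₗ[ℂ] V)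
    (he : e * e = e) (hcomm : ∀ g, ρ g * e = e * ρ g) :
    IsCharacter G (fun g => LinearMap.trace ℂ V (ρ g * e)) := by
  have hmem (g : G) : ∀ v ∈ LinearMap.range e, ρ g v ∈ LinearMap.range e := by
    rintro _ ⟨v, rfl⟩
    exact ⟨ρ g v, (LinearMap.congr_fun (hcomm g) v).symm⟩
  let σ : Representation ℂ G (LinearMap.range e) :=
    { toFun := fun g => (ρ g).restrict (hmem g)
      map_one' := by ext v; simp
      map_mul' := fun g h => by ext v; simp }
  have hσ : (fun g => LinearMap.trace ℂ V (ρ g * e)) = σ.character := by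
    funext g
    have hrange (v : V) : (ρ g * e) v ∈ LinearMap.range e := hmem g _ ⟨v, rfl⟩
    rw [← LinearMap.trace_restrict_eq_of_forall_mem (LinearMap.range e) (ρ g * e) hrange]
    refine congrArg _ (LinearMap.ext ?_)
    rintro ⟨_, v, rfl⟩
    refine Subtype.ext ?_
    change ρ g (e (e v)) = ρ g (e v)
    rw [← Module.End.mul_apply e e, he]
  rw [hσ]
  exact isCharacter_character σ

theorem exists_representation_of_isCharacter {f : G → ℂ} (hf : IsCharacter G f) :
    ∃ V : FDRep ℂ G, f = Representation.character V.ρ := hf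

theorem IsCharacter.map_conj {f : G → ℂ} (hf : IsCharacter G f) (t g : G) :
    f (t * g * t⁻¹) = f g := by
  obtain ⟨V, rfl⟩ := hf
  exact V.char_conj g t

theorem IsCharacter.restrict {f : G → ℂ} (hf : IsCharacter G f) (H : Subgroup G) :
    IsCharacter H (fun h => f h) := by
  obtain ⟨V, rfl⟩ := hf
  exact isCharacter_character (V.ρ.comp H.subtype)

end Characters

/-! ### Induced characters -/

section Induction

open Module

variable {G : Type} [Group G]

/-- Extension by zero of a function on a subgroup. -/
def extendZero (H : Subgroup G) (ψ : ↥H → ℂ) (g : G) : ℂ :=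
  if h : g ∈ H then ψ ⟨g, h⟩ else 0

theorem extendZero_of_mem (H : Subgroup G) (ψ : ↥H → ℂ) {g : G} (h : g ∈ H) :
    extendZero H ψ g = ψ ⟨g, h⟩ := dif_pos h

theorem extendZero_of_notMem (H : Subgroup G) (ψ : ↥H → ℂ) {g : G} (h : g ∉ H) :
    extendZero H ψ g = 0 := dif_neg h

theorem sum_extendZero_mul [Fintype G] (H : Subgroup G) (ψ : ↥H → ℂ) (f : G → ℂ) :
    ∑ g : G, extendZero H ψ g * f g = ∑ h : ↥H, ψ h * f h := by
  rw [← Finset.sum_subset (Finset.subset_univ (Finset.univ.filter (· ∈ H)))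
    (fun g _ hg => by
      rw [extendZero_of_notMem H ψ (by simpa using hg), zero_mul])]
  rw [Finset.sum_subtype (p := (· ∈ H)) _ (by simp)]
  exact Finset.sum_congr rfl fun h _ => by rw [extendZero_of_mem H ψ h.2]

theorem indFun_eq_sum [Fintype G] (H : Subgroup G) (ψ : ↥H → ℂ) (g : G) :
    indFun H ψ g = (Fintype.card ↥H : ℂ)⁻¹ * ∑ x : G, extendZero H ψ (x * g * x⁻¹) := by
  rw [indFun, finsum_eq_sum_of_fintype, Nat.card_eq_fintype_card]
  rfl

theorem indFun_conj [Fintype G] (H : Subgroup G) (ψ : ↥H → ℂ) (t g : G) :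
    indFun H ψ (t * g * t⁻¹) = indFun H ψ g := by
  rw [indFun_eq_sum, indFun_eq_sum, ← Equiv.sum_comp (Equiv.mulRight t)
    (fun x => extendZero H ψ (x * g * x⁻¹))]
  simp [mul_assoc]

/-- Frobenius reciprocity. -/
theorem innerG_indFun [Fintype G] (H : Subgroup G) (ψ : ↥H → ℂ) {f : G → ℂ}
    (hf : ∀ t g, f (t * g * t⁻¹) = f g) :
    innerG G (indFun H ψ) f = innerG H ψ (fun h => f h) := by
  have hx (x : G) : ∑ g : G, extendZero H ψ (x * g * x⁻¹) * (starRingEnd ℂ) (f g)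
      = ∑ h : ↥H, ψ h * (starRingEnd ℂ) (f h) := by
    rw [← sum_extendZero_mul H ψ (fun g => (starRingEnd ℂ) (f g)),
      ← Equiv.sum_comp (MulAut.conj x).toEquiv
        (fun g => extendZero H ψ g * (starRingEnd ℂ) (f g))]
    simp [hf]
  have hsum : ∑ g : G, indFun H ψ g * (starRingEnd ℂ) (f g) = (Fintype.card G : ℂ) *
      ((Fintype.card ↥H : ℂ)⁻¹ * ∑ h : ↥H, ψ h * (starRingEnd ℂ) (f h)) := by
    simp only [indFun_eq_sum, mul_assoc (_ : ℂ), Finset.sum_mul]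
    rw [← Finset.mul_sum, Finset.sum_comm]
    simp only [hx, Finset.sum_const, Finset.card_univ, nsmul_eq_mul]
    ring
  rw [innerG_eq_sum, innerG_eq_sum, hsum, inv_mul_cancel_left₀ (by simp)]

variable {V : Type} [AddCommGroup V] [Module ℂ V] [FiniteDimensional ℂ V]

/-- Right translation on the space of functions `G → V`. -/
def rightTranslation (G V : Type) [Group G] [AddCommGroup V] [Module ℂ V] :
    Representation ℂ G (G → V) where
  toFun g := LinearMap.funLeft ℂ V (· * g)
  map_one' := by ext; simp [LinearMap.funLeft_apply]
  map_mul' g h := by ext; simp [LinearMap.funLeft_apply, mul_assoc]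

/-- The projection of `G → V` onto the space of the induced representation. -/
def inducedProj [Fintype G] (H : Subgroup G) (ρ : Representation ℂ H V) :
    (G → V) →ₗ[ℂ] (G → V) :=
  (Fintype.card H : ℂ)⁻¹ •
    ∑ s : H, (ρ s⁻¹).compLeft G ∘ₗ LinearMap.funLeft ℂ V ((s : G) * ·)

theorem inducedProj_apply [Fintype G] (H : Subgroup G) (ρ : Representation ℂ H V)
    (f : G → V) (x : G) :
    inducedProj H ρ f x = (Fintype.card H : ℂ)⁻¹ • ∑ s : H, ρ s⁻¹ (f (s * x)) := by
  simp [inducedProj, LinearMap.funLeft_apply, Finset.sum_apply]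

theorem inducedProj_mul_apply [Fintype G] (H : Subgroup G) (ρ : Representation ℂ H V)
    (f : G → V) (t : H) (x : G) :
    inducedProj H ρ f (t * x) = ρ t (inducedProj H ρ f x) := by
  rw [inducedProj_apply, inducedProj_apply, map_smul, map_sum,
    ← Equiv.sum_comp (Equiv.mulRight t) (fun s => ρ t (ρ s⁻¹ (f (s * x))))]
  congr 1
  refine Finset.sum_congr rfl fun s _ => ?_
  rw [← Module.End.mul_apply, ← map_mul]
  simp [mul_assoc]

theorem inducedProj_idem [Fintype G] (H : Subgroup G) (ρ : Representation ℂ H V) :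
    inducedProj H ρ * inducedProj H ρ = inducedProj H ρ := by
  refine LinearMap.ext fun f => funext fun x => ?_
  rw [Module.End.mul_apply, inducedProj_apply]
  have (s : H) : ρ s⁻¹ (inducedProj H ρ f (s * x)) = inducedProj H ρ f x := by
    rw [inducedProj_mul_apply, ← Module.End.mul_apply, ← map_mul]
    simp
  simp only [this, Finset.sum_const, Finset.card_univ]
  rw [← Nat.cast_smul_eq_nsmul ℂ, smul_smul, inv_mul_cancel₀ (by simp), one_smul]

theorem trace_pi [Fintype G] (T : (G → V) →ₗ[ℂ] (G → V)) :
    LinearMap.trace ℂ (G → V) T = ∑ x, LinearMap.trace ℂ V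
      (LinearMap.proj x ∘ₗ T ∘ₗ LinearMap.single ℂ (fun _ => V) x) := by
  let b := Module.finBasis ℂ V
  rw [LinearMap.trace_eq_matrix_trace ℂ (Pi.basis fun _ : G => b), Matrix.trace,
    Fintype.sum_sigma]
  refine Finset.sum_congr rfl fun x _ => ?_
  rw [LinearMap.trace_eq_matrix_trace ℂ b, Matrix.trace]
  refine Finset.sum_congr rfl fun i _ => ?_
  simp [LinearMap.toMatrix_apply, Pi.basis_apply]

/-- Induction of class functions takes characters to characters. -/
theorem IsCharacter.indFun [Fintype G] {H : Subgroup G} {ψ : ↥H → ℂ} (hψ : IsCharacter H ψ) :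
    IsCharacter G (indFun H ψ) := by
  obtain ⟨W, rfl⟩ := exists_representation_of_isCharacter hψ
  convert isCharacter_of_idempotent (rightTranslation G W) (inducedProj H W.ρ)
    (inducedProj_idem H W.ρ) ?_ using 1
  · funext g
    rw [trace_pi, indFun_eq_sum, Finset.mul_sum]
    refine Finset.sum_congr rfl fun x _ => ?_
    have key : LinearMap.proj x ∘ₗ (rightTranslation G W g * inducedProj H W.ρ) ∘ₗ
        LinearMap.single ℂ (fun _ => W) x = (Fintype.card H : ℂ)⁻¹ •
          ∑ s : H, if (s : G) * (x * g) = x then W.ρ s⁻¹ else 0 := by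
      refine LinearMap.ext fun w => ?_
      change inducedProj H W.ρ (Pi.single x w) (x * g) = _
      rw [inducedProj_apply, LinearMap.smul_apply, LinearMap.sum_apply]
      congr 1
      refine Finset.sum_congr rfl fun s _ => ?_
      by_cases h : (s : G) * (x * g) = x
      · rw [if_pos h, h, Pi.single_eq_same]
      · rw [if_neg h, Pi.single_eq_of_ne h, map_zero, LinearMap.zero_apply]
    rw [key, map_smul, map_sum, smul_eq_mul]
    congr 1
    have hiff (s : H) : (s : G) * (x * g) = x ↔ ((s⁻¹ : H) : G) = x * g * x⁻¹ := by
      rw [Subgroup.coe_inv, eq_mul_inv_iff_mul_eq, inv_mul_eq_iff_eq_mul, eq_comm]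
    by_cases hmem : x * g * x⁻¹ ∈ H
    · rw [extendZero_of_mem H _ hmem,
        Finset.sum_eq_single_of_mem (⟨x * g * x⁻¹, hmem⟩ : H)⁻¹ (Finset.mem_univ _)]
      · rw [if_pos ((hiff _).mpr (by simp)), inv_inv]
        rfl
      · intro s _ hs
        rw [if_neg, map_zero]
        intro h
        exact hs (by rw [← inv_inv s]; exact congrArg _ (Subtype.ext ((hiff s).mp h)))
    · rw [extendZero_of_notMem H _ hmem]
      refine (Finset.sum_eq_zero fun s _ => ?_).symm
      rw [if_neg, map_zero]
      intro h
      exact hmem ((hiff s).mp h ▸ (s⁻¹).2)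
  · intro g
    refine LinearMap.ext fun f => funext fun x => ?_
    change inducedProj H W.ρ f (x * g) = inducedProj H W.ρ (fun y => f (y * g)) x
    simp [inducedProj_apply, mul_assoc]

end Induction

/-! ### Characters lying over an invariant linear character of a normal subgroup -/

section Clifford

open Module

variable {G : Type} [Group G]

/-- The function `θ` restricts to a linear character of the subgroup `L`. -/
structure IsLinearCharOn (L : Subgroup G) (θ : G → ℂ) : Prop where
  map_one : θ 1 = 1
  map_mul : ∀ x ∈ L, ∀ y ∈ L, θ (x * y) = θ x * θ y

/-- Right multiplication by `L` acts on the function `f` through `θ`. -/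
def IsEquivariant (L : Subgroup G) (θ f : G → ℂ) : Prop :=
  ∀ s, ∀ x ∈ L, f (s * x) = f s * θ x

/-- Conjugation preserves `L` and the values of `θ` on it. -/
def IsConjInvariant (L : Subgroup G) (θ : G → ℂ) : Prop :=
  ∀ s, ∀ x ∈ L, s * x * s⁻¹ ∈ L ∧ θ (s * x * s⁻¹) = θ x

theorem IsLinearCharOn.map_inv {L : Subgroup G} {θ : G → ℂ} (hθ : IsLinearCharOn L θ)
    {x : G} (hx : x ∈ L) : θ x⁻¹ = (θ x)⁻¹ :=
  eq_inv_of_mul_eq_one_left (by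
    rw [← hθ.map_mul _ (inv_mem hx) _ hx, inv_mul_cancel, hθ.map_one])

theorem IsLinearCharOn.ne_zero {L : Subgroup G} {θ : G → ℂ} (hθ : IsLinearCharOn L θ)
    {x : G} (hx : x ∈ L) : θ x ≠ 0 := by
  intro h
  have := hθ.map_mul x hx _ (inv_mem hx)
  simp [h, hθ.map_one] at this

theorem IsLinearCharOn.conj_eq [Fintype G] {L : Subgroup G} {θ : G → ℂ}
    (hθ : IsLinearCharOn L θ) {x : G} (hx : x ∈ L) : (starRingEnd ℂ) (θ x) = θ x⁻¹ := by
  have hpow (n : ℕ) : θ (x ^ n) = θ x ^ n := by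
    induction n with
    | zero => simp [hθ.map_one]
    | succ n ih => rw [pow_succ, hθ.map_mul _ (pow_mem hx n) _ hx, ih, pow_succ]
  have hnorm : ‖θ x‖ = 1 := by
    refine Complex.norm_eq_one_of_pow_eq_one (n := Fintype.card G) ?_ Fintype.card_ne_zero
    rw [← hpow, pow_card_eq_one, hθ.map_one]
  rw [hθ.map_inv hx, Complex.inv_eq_conj hnorm]

/-- The projection onto the functions on which `L` acts through `θ`. -/
def equivariantPart [Fintype G] (L : Subgroup G) (θ f : G → ℂ) (s : G) : ℂ :=
  (Fintype.card L : ℂ)⁻¹ * ∑ x : L, (starRingEnd ℂ) (θ x) * f (s * x)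

theorem isEquivariant_equivariantPart [Fintype G] {L : Subgroup G} {θ : G → ℂ}
    (hθ : IsLinearCharOn L θ) (f : G → ℂ) : IsEquivariant L θ (equivariantPart L θ f) := by
  intro s y hy
  rw [equivariantPart, equivariantPart, mul_assoc, Finset.sum_mul,
    ← Equiv.sum_comp (Equiv.mulLeft (⟨y, hy⟩ : L))
      (fun x : L => (starRingEnd ℂ) (θ x) * f (s * x) * θ y)]
  congr 1
  refine Finset.sum_congr rfl fun x _ => ?_
  have hne := hθ.ne_zero hy
  simp only [Equiv.coe_mulLeft, Subgroup.coe_mul, hθ.map_mul _ hy _ x.2, _root_.map_mul,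
    hθ.conj_eq hy, hθ.map_inv hy, mul_assoc]
  field_simp

theorem innerG_equivariantPart [Fintype G] {L : Subgroup G} {θ φ : G → ℂ}
    (hθ : IsLinearCharOn L θ) (hφ : IsEquivariant L θ φ) (f : G → ℂ) :
    innerG G φ (equivariantPart L θ f) = innerG G φ f := by
  have hx (x : L) : ∑ s : G, φ s * (θ x * (starRingEnd ℂ) (f (s * x)))
      = ∑ s : G, φ s * (starRingEnd ℂ) (f s) := by
    rw [← Equiv.sum_comp (Equiv.mulRight (x : G)) (fun s => φ s * (starRingEnd ℂ) (f s))]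
    simp [hφ _ x x.2, mul_assoc]
  rw [innerG_eq_sum, innerG_eq_sum]
  congr 1
  simp only [equivariantPart, _root_.map_mul, map_sum, Complex.conj_conj, map_inv₀, map_natCast,
    Finset.mul_sum, mul_left_comm _ (Fintype.card L : ℂ)⁻¹]
  rw [Finset.sum_comm]
  simp only [← Finset.mul_sum, hx, Finset.sum_const, Finset.card_univ, nsmul_eq_mul]
  rw [inv_mul_cancel_left₀ (by simp)]

variable {V : Type} [AddCommGroup V] [Module ℂ V] [FiniteDimensional ℂ V]

/-- The projection of a representation onto the space where `L` acts through `θ`. -/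
def isotypicProj [Fintype G] (ρ : Representation ℂ G V) (L : Subgroup G) (θ : G → ℂ) :
    V →ₗ[ℂ] V :=
  (Fintype.card L : ℂ)⁻¹ • ∑ x : L, (starRingEnd ℂ) (θ x) • ρ x

theorem trace_mul_isotypicProj [Fintype G] (ρ : Representation ℂ G V) (L : Subgroup G)
    (θ : G → ℂ) (s : G) :
    LinearMap.trace ℂ V (ρ s * isotypicProj ρ L θ) = equivariantPart L θ ρ.character s := by
  simp [isotypicProj, equivariantPart, Finset.mul_sum, Representation.character]

theorem rep_mul_isotypicProj [Fintype G] (ρ : Representation ℂ G V) {L : Subgroup G}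
    {θ : G → ℂ} (hθ : IsLinearCharOn L θ) {y : G} (hy : y ∈ L) :
    ρ y * isotypicProj ρ L θ = θ y • isotypicProj ρ L θ := by
  rw [isotypicProj, smul_comm, mul_smul_comm]
  congr 1
  rw [Finset.mul_sum, Finset.smul_sum,
    ← Equiv.sum_comp (Equiv.mulLeft (⟨y, hy⟩ : L))
      (fun x : L => θ y • (starRingEnd ℂ) (θ x) • ρ x)]
  refine Finset.sum_congr rfl fun x _ => ?_
  have hne := hθ.ne_zero hy
  simp only [Equiv.coe_mulLeft, Subgroup.coe_mul, hθ.map_mul _ hy _ x.2, _root_.map_mul,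
    hθ.conj_eq hy, hθ.map_inv hy, mul_smul_comm, smul_smul]
  rw [mul_inv_cancel_left₀ hne]

theorem isotypicProj_idem [Fintype G] (ρ : Representation ℂ G V) {L : Subgroup G}
    {θ : G → ℂ} (hθ : IsLinearCharOn L θ) :
    isotypicProj ρ L θ * isotypicProj ρ L θ = isotypicProj ρ L θ := by
  nth_rewrite 1 [isotypicProj]
  rw [smul_mul_assoc, Finset.sum_mul]
  have (x : L) : (starRingEnd ℂ) (θ x) • ρ x * isotypicProj ρ L θ = isotypicProj ρ L θ := by
    rw [smul_mul_assoc, rep_mul_isotypicProj ρ hθ x.2, smul_smul, hθ.conj_eq x.2,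
      hθ.map_inv x.2, inv_mul_cancel₀ (hθ.ne_zero x.2), one_smul]
  simp only [this, Finset.sum_const, Finset.card_univ]
  rw [← Nat.cast_smul_eq_nsmul ℂ, smul_smul, inv_mul_cancel₀ (by simp), one_smul]

theorem rep_mul_isotypicProj_comm [Fintype G] (ρ : Representation ℂ G V) {L : Subgroup G}
    {θ : G → ℂ} (hinv : IsConjInvariant L θ) (s : G) :
    ρ s * isotypicProj ρ L θ = isotypicProj ρ L θ * ρ s := by
  let c : L ≃ L :=
    { toFun := fun x => ⟨s * x * s⁻¹, (hinv s x x.2).1⟩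
      invFun := fun x => ⟨s⁻¹ * x * s, by simpa using (hinv s⁻¹ x x.2).1⟩
      left_inv := fun x => Subtype.ext (by simp [mul_assoc])
      right_inv := fun x => Subtype.ext (by simp [mul_assoc]) }
  rw [isotypicProj, mul_smul_comm, smul_mul_assoc, Finset.mul_sum, Finset.sum_mul,
    ← Equiv.sum_comp c (fun x : L => (starRingEnd ℂ) (θ x) • ρ x * ρ s)]
  congr 1
  refine Finset.sum_congr rfl fun x _ => ?_
  simp only [c, Equiv.coe_fn_mk, (hinv s x x.2).2, mul_smul_comm, smul_mul_assoc, ← map_mul,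
    inv_mul_cancel_right]

theorem isCharacter_equivariantPart [Fintype G] {L : Subgroup G} {θ f : G → ℂ}
    (hθ : IsLinearCharOn L θ) (hinv : IsConjInvariant L θ) (hf : IsCharacter G f) :
    IsCharacter G (equivariantPart L θ f) := by
  obtain ⟨V, rfl⟩ := exists_representation_of_isCharacter hf
  convert isCharacter_of_idempotent V.ρ (isotypicProj V.ρ L θ) (isotypicProj_idem V.ρ hθ)
    (rep_mul_isotypicProj_comm V.ρ hinv) using 1
  funext s
  exact (trace_mul_isotypicProj V.ρ L θ s).symm

/-- An irreducible character that pairs nontrivially with an equivariant function is itself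
equivariant. -/
theorem isEquivariant_of_irr [Fintype G] {L : Subgroup G} {θ α f : G → ℂ}
    (hθ : IsLinearCharOn L θ) (hinv : IsConjInvariant L θ) (hα : IsEquivariant L θ α)
    (hf : f ∈ Irr G) (hne : innerG G α f ≠ 0) : IsEquivariant L θ f := by
  obtain ⟨hchar, hnorm⟩ := hf
  obtain ⟨V, rfl⟩ := exists_representation_of_isCharacter hchar
  have he : isotypicProj V.ρ L θ ≠ 0 := by
    intro h0
    apply hne
    have hzero : equivariantPart L θ (Representation.character V.ρ) = 0 := by
      funext s
      rw [← trace_mul_isotypicProj, h0, mul_zero, map_zero]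
      rfl
    rw [← innerG_equivariantPart hθ hα, hzero]
    simp [innerG_eq_sum]
  rw [innerG_character] at hnorm
  let E : Representation.IntertwiningMap V.ρ V.ρ :=
    ⟨isotypicProj V.ρ L θ, fun s => (rep_mul_isotypicProj_comm V.ρ hinv s).symm⟩
  have hE : E ≠ 0 := fun h => he (congrArg Representation.IntertwiningMap.toLinearMap h)
  obtain ⟨c, hc⟩ := (finrank_eq_one_iff_of_nonzero' E hE).mp (by exact_mod_cast hnorm)
    (Representation.IntertwiningMap.id V.ρ)
  have hc' : c • isotypicProj V.ρ L θ = 1 :=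
    congrArg Representation.IntertwiningMap.toLinearMap hc
  have hone : isotypicProj V.ρ L θ = 1 := by
    calc isotypicProj V.ρ L θ = (c • isotypicProj V.ρ L θ) * isotypicProj V.ρ L θ := by
          rw [hc', one_mul]
      _ = 1 := by rw [smul_mul_assoc, isotypicProj_idem V.ρ hθ, hc']
  have hpart : Representation.character V.ρ
      = equivariantPart L θ (Representation.character V.ρ) := by
    funext s
    rw [← trace_mul_isotypicProj, hone, mul_one]
    rfl
  rw [hpart]
  exact isEquivariant_equivariantPart hθ _

end Clifford

/-! ### A Clifford-type correspondence for induction from `S` to `G` -/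

section Correspondence

variable {G : Type} [Group G]

theorem extendZero_mul {S L : Subgroup G} (hLS : L ≤ S) {θ : G → ℂ} {ψ : ↥S → ℂ}
    (hψ : IsEquivariant (L.subgroupOf S) (fun s : ↥S => θ s) ψ) (a : G) {y : G} (hy : y ∈ L) :
    extendZero S ψ (a * y) = extendZero S ψ a * θ y := by
  by_cases ha : a ∈ S
  · rw [extendZero_of_mem S ψ ha, extendZero_of_mem S ψ (mul_mem ha (hLS hy))]
    exact hψ ⟨a, ha⟩ ⟨y, hLS hy⟩ (Subgroup.mem_subgroupOf.mpr hy)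
  · rw [extendZero_of_notMem S ψ ha, zero_mul, extendZero_of_notMem S ψ]
    exact fun h => ha ((Subgroup.mul_mem_cancel_right S (hLS hy)).mp h)

/-- If no element outside `S` intertwines the linear character `θ` of `L` with itself, then
restricting an induced equivariant class function back to `S` does not change its inner product
with equivariant functions. -/
theorem innerG_restrict_indFun [Fintype G] {S L : Subgroup G} (hLS : L ≤ S) {θ : G → ℂ}
    (hθ : IsLinearCharOn L θ)
    (hsep : ∀ g ∉ S, ∃ x ∈ L, g * x * g⁻¹ ∈ L ∧ θ (g * x * g⁻¹) ≠ θ x)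
    {ψ φ : ↥S → ℂ} (hψ : IsEquivariant (L.subgroupOf S) (fun s : ↥S => θ s) ψ)
    (hψc : ∀ t s, ψ (t * s * t⁻¹) = ψ s)
    (hφ : IsEquivariant (L.subgroupOf S) (fun s : ↥S => θ s) φ) :
    innerG S (fun s => indFun S ψ s) φ = innerG S ψ φ := by
  have hin (g : G) (hg : g ∈ S) :
      ∑ s : ↥S, extendZero S ψ (g * s * g⁻¹) * (starRingEnd ℂ) (φ s)
        = ∑ s : ↥S, ψ s * (starRingEnd ℂ) (φ s) := by
    refine Finset.sum_congr rfl fun s _ => ?_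
    rw [extendZero_of_mem S ψ (mul_mem (mul_mem hg s.2) (inv_mem hg))]
    congr 1
    exact hψc ⟨g, hg⟩ s
  have hout (g : G) (hg : g ∉ S) :
      ∑ s : ↥S, extendZero S ψ (g * s * g⁻¹) * (starRingEnd ℂ) (φ s) = 0 := by
    obtain ⟨x, hx, hgx, hne⟩ := hsep g hg
    set T := ∑ s : ↥S, extendZero S ψ (g * s * g⁻¹) * (starRingEnd ℂ) (φ s) with hT
    have hscale : T = θ (g * x * g⁻¹) * (starRingEnd ℂ) (θ x) * T := by
      conv_lhs => rw [hT, ← Equiv.sum_comp (Equiv.mulRight (⟨x, hLS hx⟩ : ↥S))]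
      rw [hT, Finset.mul_sum]
      refine Finset.sum_congr rfl fun s _ => ?_
      have h1 : g * ((s * ⟨x, hLS hx⟩ : ↥S) : G) * g⁻¹ = (g * s * g⁻¹) * (g * x * g⁻¹) := by
        simp [mul_assoc]
      have h2 : φ (s * ⟨x, hLS hx⟩) = φ s * θ x :=
        hφ s ⟨x, hLS hx⟩ (Subgroup.mem_subgroupOf.mpr hx)
      rw [Equiv.coe_mulRight, h1, h2, extendZero_mul hLS hψ _ hgx, map_mul]
      ring
    by_contra hT0
    have hone : θ (g * x * g⁻¹) * (starRingEnd ℂ) (θ x) = 1 :=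
      mul_right_cancel₀ hT0 (by rw [one_mul]; exact hscale.symm)
    rw [hθ.conj_eq hx, hθ.map_inv hx, mul_inv_eq_one₀ (hθ.ne_zero hx)] at hone
    exact hne hone
  have hsum : ∑ s : ↥S, indFun S ψ s * (starRingEnd ℂ) (φ s)
      = ∑ s : ↥S, ψ s * (starRingEnd ℂ) (φ s) := by
    simp only [indFun_eq_sum, mul_assoc (_ : ℂ), Finset.sum_mul]
    rw [← Finset.mul_sum, Finset.sum_comm]
    have hite (g : G) : ∑ s : ↥S, extendZero S ψ (g * s * g⁻¹) * (starRingEnd ℂ) (φ s)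
        = if g ∈ S then ∑ s : ↥S, ψ s * (starRingEnd ℂ) (φ s) else 0 := by
      split_ifs with hg
      exacts [hin g hg, hout g hg]
    simp only [hite]
    rw [← Finset.sum_filter, Finset.sum_const, nsmul_eq_mul, ← Fintype.card_subtype]
    exact inv_mul_cancel_left₀ (by simp) _
  rw [innerG_eq_sum, innerG_eq_sum, hsum]

/-- Transitivity of induction, seen through inner products with class functions. -/
theorem innerG_indFun_restrict [Fintype G] {S L : Subgroup G} (hLS : L ≤ S) (θ : G → ℂ)
    {f : G → ℂ} (hf : ∀ t g, f (t * g * t⁻¹) = f g) :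
    innerG G (indFun L fun x => θ x) f
      = innerG S (indFun (L.subgroupOf S) fun x => θ (x : ↥S)) (fun s => f s) := by
  rw [innerG_indFun L _ hf, innerG_indFun (L.subgroupOf S) _ (fun t g => hf t g),
    innerG_eq_sum, innerG_eq_sum, Fintype.card_congr (Subgroup.subgroupOfEquivOfLe hLS).toEquiv,
    ← Equiv.sum_comp (Subgroup.subgroupOfEquivOfLe hLS).toEquiv]
  rfl

theorem isEquivariant_indFun [Fintype G] {L : Subgroup G} {θ : G → ℂ}
    (hθ : IsLinearCharOn L θ) (hinv : IsConjInvariant L θ) :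
    IsEquivariant L θ (indFun L fun x => θ x) := by
  intro s x hx
  have hθL : IsEquivariant (L.subgroupOf L) (fun s : ↥L => θ s) (fun y : ↥L => θ y) :=
    fun a b _ => hθ.map_mul a a.2 b b.2
  rw [indFun_eq_sum, indFun_eq_sum, mul_assoc, Finset.sum_mul]
  congr 1
  refine Finset.sum_congr rfl fun t _ => ?_
  have h1 : t * (s * x) * t⁻¹ = (t * s * t⁻¹) * (t * x * t⁻¹) := by simp [mul_assoc]
  rw [h1, extendZero_mul le_rfl hθL _ (hinv t x hx).1, (hinv t x hx).2]

/-- Suppose `θ` is an `S`-invariant linear character of the normal subgroup `L` of `S`, and that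
no element of `G` outside `S` intertwines `θ` with itself. Then induction from `S` to `G` is a
bijection between the irreducible characters of `S` and of `G` lying over `θ`. -/
theorem bijOn_indFun [Fintype G] {S L : Subgroup G} (hLS : L ≤ S) {θ : G → ℂ}
    (hθ : IsLinearCharOn L θ)
    (hinv : ∀ s ∈ S, ∀ x ∈ L, s * x * s⁻¹ ∈ L ∧ θ (s * x * s⁻¹) = θ x)
    (hsep : ∀ g ∉ S, ∃ x ∈ L, g * x * g⁻¹ ∈ L ∧ θ (g * x * g⁻¹) ≠ θ x) :
    Set.BijOn (fun ψ : ↥S → ℂ => indFun S ψ)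
      (IrrConstituents S (indFun (L.subgroupOf S) fun x => θ (x : ↥S)))
      (IrrConstituents G (indFun L fun x => θ x)) := by
  have hθS : IsLinearCharOn (L.subgroupOf S) (fun s : ↥S => θ s) :=
    ⟨hθ.map_one, fun x hx y hy => hθ.map_mul x hx y hy⟩
  have hinvS : IsConjInvariant (L.subgroupOf S) (fun s : ↥S => θ s) :=
    fun s x hx => hinv s s.2 x hx
  set α := indFun (L.subgroupOf S) fun x => θ (x : ↥S) with hα
  have hαeq : IsEquivariant (L.subgroupOf S) (fun s : ↥S => θ s) α :=
    isEquivariant_indFun hθS hinvS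
  have hisom {ψ φ : ↥S → ℂ} (hψ : IsEquivariant (L.subgroupOf S) (fun s : ↥S => θ s) ψ)
      (hψc : ∀ t s, ψ (t * s * t⁻¹) = ψ s)
      (hφ : IsEquivariant (L.subgroupOf S) (fun s : ↥S => θ s) φ)
      (hφc : ∀ t s, φ (t * s * t⁻¹) = φ s) :
      innerG G (indFun S ψ) (indFun S φ) = innerG S ψ φ := by
    rw [innerG_indFun S ψ (indFun_conj S φ), ← innerG_conj_symm,
      innerG_restrict_indFun hLS hθ hsep hφ hφc hψ, innerG_conj_symm]
  have heq {ψ : ↥S → ℂ} (hψ : ψ ∈ IrrConstituents S α) :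
      IsEquivariant (L.subgroupOf S) (fun s : ↥S => θ s) ψ :=
    isEquivariant_of_irr hθS hinvS hαeq hψ.1 hψ.2.ne'
  refine ⟨fun ψ hψ => ?_, fun ψ hψ φ hφ h => ?_, fun χ hχ => ?_⟩
  · have hc := hψ.1.1.map_conj
    refine ⟨⟨hψ.1.1.indFun, by rw [hisom (heq hψ) hc (heq hψ) hc]; exact hψ.1.2⟩, ?_⟩
    rw [innerG_indFun_restrict hLS θ (indFun_conj S ψ), ← hα, ← innerG_conj_symm,
      innerG_restrict_indFun hLS hθ hsep (heq hψ) hc hαeq, innerG_conj_symm]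
    exact hψ.2
  · have hψc := hψ.1.1.map_conj
    have hφc := hφ.1.1.map_conj
    have h' : indFun S ψ = indFun S φ := h
    refine sub_eq_zero.mp (eq_zero_of_innerG_self ?_)
    rw [innerG_sub_left, innerG_sub_right, innerG_sub_right,
      ← hisom (heq hψ) hψc (heq hψ) hψc, ← hisom (heq hψ) hψc (heq hφ) hφc,
      ← hisom (heq hφ) hφc (heq hψ) hψc, ← hisom (heq hφ) hφc (heq hφ) hφc, h']
    ring
  · obtain ⟨⟨hχ, hnorm⟩, hpos⟩ := hχ
    have hχS : IsCharacter S (fun s => χ s) := hχ.restrict S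
    set ψ := equivariantPart (L.subgroupOf S) (fun s : ↥S => θ s) (fun s => χ s) with hψ
    have hψchar : IsCharacter S ψ := isCharacter_equivariantPart hθS hinvS hχS
    have hψeq : IsEquivariant (L.subgroupOf S) (fun s : ↥S => θ s) ψ :=
      isEquivariant_equivariantPart hθS _
    have hψc := hψchar.map_conj
    have hαψ : 0 < innerG S α ψ := by
      rw [hψ, innerG_equivariantPart hθS hαeq, hα,
        ← innerG_indFun_restrict hLS θ hχ.map_conj]
      exact hpos
    have hself : innerG G (indFun S ψ) χ = innerG S ψ ψ := by
      rw [innerG_indFun S ψ hχ.map_conj, ← innerG_equivariantPart hθS hψeq]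
    obtain ⟨W, hW⟩ := exists_representation_of_isCharacter hψchar
    obtain ⟨n, hn⟩ : ∃ n : ℕ, innerG S ψ ψ = n := ⟨_, by rw [hW, innerG_character]⟩
    have hdiff : innerG G (indFun S ψ - χ) (indFun S ψ - χ) = 1 - n := by
      rw [innerG_sub_left, innerG_sub_right, innerG_sub_right, ← innerG_conj_symm _ χ, hself,
        hisom hψeq hψc hψeq hψc, hn, hnorm]
      simp
    have hn0 : n ≠ 0 := by
      rintro rfl
      rw [eq_zero_of_innerG_self (hn.trans Nat.cast_zero)] at hαψ
      simp [innerG_eq_sum] at hαψ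
    have hn1 : n ≤ 1 := by
      have h0 := innerG_self_nonneg (indFun S ψ - χ)
      rw [hdiff, sub_nonneg] at h0
      exact_mod_cast h0
    obtain rfl : n = 1 := by omega
    refine ⟨ψ, ⟨⟨hψchar, by rw [hn, Nat.cast_one]⟩, hαψ⟩, ?_⟩
    exact sub_eq_zero.mp (eq_zero_of_innerG_self (by rw [hdiff]; simp))

end Correspondence

/-! ### The stable subalgebras and the associated linear character -/

section StableSubalgebras

theorem sChain_succ_le (J : NonUnitalSubalgebra F R) (lam : ↥J →ₗ[F] F) (i : ℕ) :
    sChain J lam (i + 1) ≤ sChain J lam i :=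
  sStep_le J lam _ _

theorem sChain_le (J : NonUnitalSubalgebra F R) (lam : ↥J →ₗ[F] F) (i : ℕ) :
    sChain J lam i ≤ J :=
  (sChainAux J lam i).2

theorem sChain_stable_of_le (J : NonUnitalSubalgebra F R) (lam : ↥J →ₗ[F] F) {i j : ℕ}
    (hij : i ≤ j) (h : sChain J lam (i + 1) = sChain J lam i) :
    sChain J lam (j + 1) = sChain J lam j := by
  induction j, hij using Nat.le_induction with
  | base => exact h
  | succ j _ ih =>
    have haux : sChainAux J lam (j + 1) = sChainAux J lam j := Subtype.ext ih
    exact congrArg (fun t : {s : NonUnitalSubalgebra F R // s ≤ J} => sStep J lam t.1 t.2) haux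

theorem sChain_card_stable (J : NonUnitalSubalgebra F R) (lam : ↥J →ₗ[F] F) :
    sChain J lam (Fintype.card R + 1) = sChain J lam (Fintype.card R) := by
  have key (n : ℕ) : (∃ i < n, sChain J lam (i + 1) = sChain J lam i) ∨
      (sChain J lam n : Set R).ncard + n ≤ Fintype.card R := by
    induction n with
    | zero =>
      right
      rw [add_zero, ← Nat.card_eq_fintype_card]
      exact Set.ncard_le_card _
    | succ n ih =>
      rcases ih with ⟨i, hi, h⟩ | ih
      · exact Or.inl ⟨i, hi.trans n.lt_succ_self, h⟩
      · by_cases h : sChain J lam (n + 1) = sChain J lam n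
        · exact Or.inl ⟨n, n.lt_succ_self, h⟩
        · right
          have hlt : (sChain J lam (n + 1) : Set R).ncard < (sChain J lam n : Set R).ncard :=
            Set.ncard_lt_ncard (SetLike.coe_ssubset_coe.mpr
              (lt_of_le_of_ne (sChain_succ_le J lam n) h)) (Set.toFinite _)
          omega
  rcases key (Fintype.card R) with ⟨i, hi, h⟩ | h
  · exact sChain_stable_of_le J lam hi.le h
  · have hpos : 0 < (sChain J lam (Fintype.card R) : Set R).ncard :=
      (Set.ncard_pos (Set.toFinite _)).mpr ⟨0, zero_mem _⟩
    omega

theorem lChain_mono (J : NonUnitalSubalgebra F R) (lam : ↥J →ₗ[F] F) :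
    Monotone (lChain J lam) := by
  refine monotone_nat_of_le_succ fun i x hx => ?_
  exact ⟨⟨hx.1, fun y hy => hx.2 y hy.1⟩, fun y hy => hx.2 y hy.1⟩

theorem lamE_mul_lbar (J : NonUnitalSubalgebra F R) (lam : ↥J →ₗ[F] F) {x y : R}
    (hx : x ∈ sbar J lam) (hy : y ∈ lbar J lam) : lamE J lam (x * y) = 0 := by
  have hx' : x ∈ sChain J lam (Fintype.card R + 1) := by
    rw [sChain_card_stable]
    exact hx
  exact hx'.2 y hy

theorem lbar_ideal_left (J : NonUnitalSubalgebra F R) (lam : ↥J →ₗ[F] F) :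
    ∀ x ∈ sbar J lam, ∀ y ∈ lbar J lam, x * y ∈ lbar J lam := fun x hx y hy =>
  ⟨mul_mem hx hy.1, fun z hz => by
    rw [mul_assoc]
    exact lamE_mul_lbar J lam hx
      ⟨mul_mem hy.1 hz, fun w hw => by rw [mul_assoc]; exact hy.2 _ (mul_mem hz hw)⟩⟩

theorem lStep_mul_mem (J : NonUnitalSubalgebra F R) (lam : ↥J →ₗ[F] F)
    {s : NonUnitalSubalgebra F R} (hs : s ≤ J) {x y : R} (hx : x ∈ lStep J lam s hs)
    (hy : y ∈ s) : x * y ∈ lStep J lam s hs :=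
  ⟨mul_mem hx.1 hy, fun w hw => by rw [mul_assoc]; exact hx.2 _ (mul_mem hy hw)⟩

/-- In a nilpotent subalgebra `k`, every `1 + X` with `X ∈ k` is an element of `1 + k`. -/
theorem exists_algGroup_eq_one_add {J k : NonUnitalSubalgebra F R} (hJ : IsNil J) (hk : k ≤ J)
    {X : R} (hX : X ∈ k) : ∃ u ∈ algGroup F R k, (u : R) = 1 + X := by
  obtain ⟨N, hN⟩ := hJ
  have hnil : IsNilpotent X := ⟨N, by
    simpa using hN (List.replicate N X)
      (fun x hx => by rw [List.eq_of_mem_replicate hx]; exact hk hX) (by simp)⟩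
  obtain ⟨u, hu⟩ := hnil.isUnit_one_add
  have hpow (n : ℕ) : ((u ^ n : Rˣ) : R) - 1 ∈ k := by
    induction n with
    | zero => simp
    | succ n ih =>
      have h : ((u ^ (n + 1) : Rˣ) : R) - 1 = (((u ^ n : Rˣ) : R) - 1) * X
          + (((u ^ n : Rˣ) : R) - 1) + X := by
        rw [pow_succ, Units.val_mul, hu]
        noncomm_ring
      rw [h]
      exact add_mem (add_mem (mul_mem ih hX) ih) hX
  refine ⟨u, ⟨by simpa [hu] using hX, ?_⟩, hu⟩
  have hinv : u⁻¹ = u ^ (Fintype.card Rˣ - 1) := by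
    rw [inv_eq_iff_mul_eq_one, ← pow_succ', Nat.sub_add_cancel Fintype.card_pos,
      pow_card_eq_one]
  rw [hinv]
  exact hpow _

/-- A functional of the form `X ↦ λ(aX)` that is nonzero somewhere on `𝔩` is nonzero at some
`X ∈ 𝔩` with `aX 𝔰 ⊆ ker λ`. -/
theorem exists_lStep_witness {J : NonUnitalSubalgebra F R} (hJ : IsNil J) (lam : ↥J →ₗ[F] F)
    {s : NonUnitalSubalgebra F R} (hs : s ≤ J) {a X : R} (hX : X ∈ lStep J lam s hs)
    (haX : lamE J lam (a * X) ≠ 0) :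
    ∃ Y ∈ lStep J lam s hs, lamE J lam (a * Y) ≠ 0 ∧ ∀ Z ∈ s, lamE J lam (a * Y * Z) = 0 := by
  by_contra! hno
  have key (n : ℕ) : ∃ w : List R, (∀ z ∈ w, z ∈ s) ∧ w.length = n ∧
      X * w.prod ∈ lStep J lam s hs ∧ lamE J lam (a * (X * w.prod)) ≠ 0 := by
    induction n with
    | zero => exact ⟨[], by simp, rfl, by simpa using hX, by simpa using haX⟩
    | succ n ih =>
      obtain ⟨w, hw, hlen, hmem, hne⟩ := ih
      obtain ⟨Z, hZ, hZne⟩ := hno _ hmem hne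
      refine ⟨w ++ [Z], ?_, by simp [hlen], ?_, ?_⟩
      · intro z hz
        rcases List.mem_append.mp hz with h | h
        · exact hw z h
        · rw [List.mem_singleton.mp h]
          exact hZ
      · simpa [mul_assoc] using lStep_mul_mem J lam hs hmem hZ
      · simpa [mul_assoc] using hZne
  obtain ⟨N, hN⟩ := hJ
  obtain ⟨w, hw, hlen, -, hne⟩ := key N
  rw [hN w (fun z hz => hs (hw z hz)) hlen, mul_zero, mul_zero, lamE_zero] at hne
  exact hne rfl

/-- An element `g ∈ 1 + 𝔰` with `g - 1 ∉ 𝔰'` fails to intertwine `θ_λ` on `1 + 𝔩`. -/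
theorem exists_separating_of_notMem_sStep {J : NonUnitalSubalgebra F R} (hJ : IsNil J)
    {θ : AddChar F ℂ} (hθ : θ ≠ 1) (lam : ↥J →ₗ[F] F) {s : NonUnitalSubalgebra F R} (hs : s ≤ J)
    {g : Rˣ} (hg : g ∈ algGroup F R s) (hg' : (g : R) - 1 ∉ sStep J lam s hs) :
    ∃ x ∈ algGroup F R (lStep J lam s hs), g * x * g⁻¹ ∈ algGroup F R (lStep J lam s hs) ∧
      θ (lamE J lam (((g * x * g⁻¹ : Rˣ) : R) - 1)) ≠ θ (lamE J lam ((x : R) - 1)) := by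
  obtain ⟨X, hX, hXne⟩ : ∃ X ∈ lStep J lam s hs, lamE J lam (((g : R) - 1) * X) ≠ 0 := by
    by_contra! h
    exact hg' ⟨hg.1, h⟩
  obtain ⟨Y, hY, hYne, hYs⟩ := exists_lStep_witness hJ lam hs hX hXne
  have hgY : (g : R) * Y ∈ lStep J lam s hs := by
    have hsplit (Z : R) : (g : R) * Z = ((g : R) - 1) * Z + Z := by noncomm_ring
    refine ⟨by rw [hsplit]; exact add_mem (mul_mem hg.1 hY.1) hY.1, fun Z hZ => ?_⟩
    rw [mul_assoc, hsplit, lamE_add J lam (hs (mul_mem hg.1 (mul_mem hY.1 hZ)))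
      (hs (mul_mem hY.1 hZ)), ← mul_assoc, hYs Z hZ, hY.2 Z hZ, add_zero]
  obtain ⟨b, hb⟩ := (AddChar.ne_one_iff).mp hθ
  set d := lamE J lam (((g : R) - 1) * Y) with hd
  set c := b / d with hc
  have hcY : c • Y ∈ lStep J lam s hs := SMulMemClass.smul_mem c hY
  have hcgY : c • ((g : R) * Y) ∈ lStep J lam s hs := SMulMemClass.smul_mem c hgY
  obtain ⟨x, hx, hxeq⟩ := exists_algGroup_eq_one_add hJ ((lStep_le J lam s hs).trans hs) hcY
  have hconj : ((g * x * g⁻¹ : Rˣ) : R) - 1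
      = c • ((g : R) * Y) * (((g⁻¹ : Rˣ) : R) - 1) + c • ((g : R) * Y) := by
    rw [Units.val_mul, Units.val_mul, hxeq, mul_add, mul_one, add_mul, Units.mul_inv,
      mul_smul_comm]
    noncomm_ring
  have hconj_mem : ((g * x * g⁻¹ : Rˣ) : R) - 1 ∈ lStep J lam s hs := by
    rw [hconj]
    exact add_mem (lStep_mul_mem J lam hs hcgY hg.2) hcgY
  refine ⟨x, hx, ?_, ?_⟩
  · obtain ⟨u, hu, hueq⟩ :=
      exists_algGroup_eq_one_add hJ ((lStep_le J lam s hs).trans hs) hconj_mem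
    have hux : u = g * x * g⁻¹ := Units.ext (by rw [hueq, add_sub_cancel])
    exact hux ▸ hu
  · have hval : lamE J lam (((g * x * g⁻¹ : Rˣ) : R) - 1) = b + lamE J lam ((x : R) - 1) := by
      have hgY' : (g : R) * Y = ((g : R) - 1) * Y + Y := by noncomm_ring
      rw [hconj, lamE_add J lam (hs (lStep_mul_mem J lam hs hcgY hg.2).1) (hs hcgY.1),
        hcgY.2 _ hg.2, zero_add, lamE_smul J lam c (hs hgY.1), hgY',
        lamE_add J lam (hs (mul_mem hg.1 hY.1)) (hs hY.1), hxeq, add_sub_cancel_left,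
        lamE_smul J lam c (hs hY.1), mul_add, ← hd, hc, div_mul_cancel₀ _ hYne]
    rw [hval, AddChar.map_add_eq_mul]
    intro h
    refine hb (mul_right_cancel₀ (b := θ (lamE J lam ((x : R) - 1))) ?_ ?_)
    · exact (AddChar.val_isUnit θ _).ne_zero
    · rw [h, one_mul]

/-- No element outside `1 + 𝔰̄_λ` intertwines `θ_λ` on `1 + 𝔩̄_λ`. -/
theorem exists_separating_of_notMem_sbar {J : NonUnitalSubalgebra F R} (hJ : IsNil J)
    {θ : AddChar F ℂ} (hθ : θ ≠ 1) (lam : ↥J →ₗ[F] F) {g : Rˣ} (hg : g ∈ algGroup F R J)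
    (hg' : g ∉ algGroup F R (sbar J lam)) :
    ∃ x ∈ algGroup F R (lbar J lam), g * x * g⁻¹ ∈ algGroup F R (lbar J lam) ∧
      θ (lamE J lam (((g * x * g⁻¹ : Rˣ) : R) - 1)) ≠ θ (lamE J lam ((x : R) - 1)) := by
  obtain ⟨i, hi, hgi, hgi'⟩ : ∃ i < Fintype.card R, g ∈ algGroup F R (sChain J lam i) ∧
      g ∉ algGroup F R (sChain J lam (i + 1)) := by
    by_contra! h
    have hall (n : ℕ) (hn : n ≤ Fintype.card R) : g ∈ algGroup F R (sChain J lam n) := by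
      induction n with
      | zero => exact hg
      | succ n ih => exact h n hn (ih (by omega))
    exact hg' (hall _ le_rfl)
  have hle : lChain J lam i ≤ lbar J lam := lChain_mono J lam hi.le
  have hmono {x : Rˣ} (hx : x ∈ algGroup F R (lChain J lam i)) :
      x ∈ algGroup F R (lbar J lam) := ⟨hle hx.1, hle hx.2⟩
  by_cases h1 : (g : R) - 1 ∈ sChain J lam (i + 1)
  · have h2 : ((g⁻¹ : Rˣ) : R) - 1 ∉ sChain J lam (i + 1) := fun h2 => hgi' ⟨h1, h2⟩
    obtain ⟨x, hx, hgx, hne⟩ := exists_separating_of_notMem_sStep hJ hθ lam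
      (sChain_le J lam i) (inv_mem hgi) h2
    have hback : g * (g⁻¹ * x * g⁻¹⁻¹) * g⁻¹ = x := by group
    refine ⟨_, hmono hgx, ?_, ?_⟩
    · rw [hback]
      exact hmono hx
    · rw [hback]
      exact hne.symm
  · obtain ⟨x, hx, hgx, hne⟩ := exists_separating_of_notMem_sStep hJ hθ lam
      (sChain_le J lam i) hgi h1
    exact ⟨x, hmono hx, hmono hgx, hne⟩

theorem thetaFn_eq (θ : AddChar F ℂ) (J : NonUnitalSubalgebra F R) (lam : ↥J →ₗ[F] F)
    (g : ↥(algGroup F R J)) :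
    thetaFn θ J lam g = θ (lamE J lam (((g : Rˣ) : R) - 1)) := by
  rw [lamE_apply J lam g.2.1]
  rfl

theorem isLinearCharOn_thetaFn (θ : AddChar F ℂ) (J : NonUnitalSubalgebra F R)
    (lam : ↥J →ₗ[F] F) : IsLinearCharOn (Lbarg J lam) (thetaFn θ J lam) where
  map_one := by simp [thetaFn_eq, lamE_zero]
  map_mul x hx y hy := by
    have hX : ((x : Rˣ) : R) - 1 ∈ lbar J lam := (Subgroup.mem_subgroupOf.mp hx).1
    have hY : ((y : Rˣ) : R) - 1 ∈ lbar J lam := (Subgroup.mem_subgroupOf.mp hy).1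
    have hXJ := lbar_le J lam hX
    have hYJ := lbar_le J lam hY
    have hprod : (((x * y : ↥(algGroup F R J)) : Rˣ) : R) - 1
        = (((x : Rˣ) : R) - 1) * (((y : Rˣ) : R) - 1) + (((x : Rˣ) : R) - 1)
          + (((y : Rˣ) : R) - 1) := by
      rw [Subgroup.coe_mul, Units.val_mul]
      noncomm_ring
    rw [thetaFn_eq, thetaFn_eq, thetaFn_eq, hprod,
      lamE_add J lam (add_mem (mul_mem hXJ hYJ) hXJ) hYJ, lamE_add J lam (mul_mem hXJ hYJ) hXJ,
      hX.2 _ hY.1, zero_add, AddChar.map_add_eq_mul]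

theorem thetaFn_conj (θ : AddChar F ℂ) (J : NonUnitalSubalgebra F R) (lam : ↥J →ₗ[F] F) :
    ∀ s ∈ Sbarg J lam, ∀ x ∈ Lbarg J lam, s * x * s⁻¹ ∈ Lbarg J lam ∧
      thetaFn θ J lam (s * x * s⁻¹) = thetaFn θ J lam x := by
  intro s hs x hx
  have hS := Subgroup.mem_subgroupOf.mp hs
  have hX := Subgroup.mem_subgroupOf.mp hx
  have hr : ∀ y ∈ lbar J lam, ∀ z ∈ sbar J lam, y * z ∈ lbar J lam :=
    fun y hy z hz => lStep_mul_mem J lam (sbar_le J lam) hy hz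
  have hl := lbar_ideal_left J lam
  refine ⟨Subgroup.mem_subgroupOf.mpr ⟨?_, ?_⟩, ?_⟩
  · exact conj_mem_aux (sbar J lam) (lbar J lam) hl hr _ hS.1 hS.2 _ hX.1
  · have h := conj_mem_aux (sbar J lam) (lbar J lam) hl hr _ hS.1 hS.2 _ hX.2
    rwa [← conj_inv] at h
  · set X : R := ((x : Rˣ) : R) - 1 with hXdef
    set A : R := ((s : Rˣ) : R) - 1 with hA
    set B : R := (((s : Rˣ)⁻¹ : Rˣ) : R) - 1 with hB
    have hsplit : (((s * x * s⁻¹ : ↥(algGroup F R J)) : Rˣ) : R) - 1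
        = (A * X + X) * B + (A * X + X) := by
      have h1 : ((s : Rˣ) : R) * (((s : Rˣ)⁻¹ : Rˣ) : R) = 1 := Units.mul_inv _
      have hcoe : (((s * x * s⁻¹ : ↥(algGroup F R J)) : Rˣ) : R)
          = ((s : Rˣ) : R) * ((x : Rˣ) : R) * (((s : Rˣ)⁻¹ : Rˣ) : R) := rfl
      rw [hcoe, ← h1, hXdef, hA, hB]
      noncomm_ring
    have hAX : A * X ∈ lbar J lam := hl _ hS.1 _ hX.1
    have hsum : A * X + X ∈ lbar J lam := add_mem hAX hX.1
    rw [thetaFn_eq, thetaFn_eq, hsplit,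
      lamE_add J lam (lbar_le J lam (hr _ hsum _ hS.2)) (lbar_le J lam hsum), hsum.2 _ hS.2,
      zero_add, lamE_add J lam (lbar_le J lam hAX) (lbar_le J lam hX.1),
      lamE_mul_lbar J lam hS.1 hX.1, zero_add]

end StableSubalgebras

theorem statement6 (F : Type) [Field F] [Fintype F]
    (R : Type) [Ring R] [Algebra F R] [Fintype R]
    (J : NonUnitalSubalgebra F R) (hJ : IsNil J)
    (θ : AddChar F ℂ) (hθ : θ ≠ 1)
    (lam : ↥J →ₗ[F] F) :
    Set.BijOn (fun ψ : ↥(Sbarg J lam) → ℂ => indFun (Sbarg J lam) ψ)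
      (IrrConstituents ↥(Sbarg J lam)
        (indFun ((Lbarg J lam).subgroupOf (Sbarg J lam))
          (fun x => thetaFn θ J lam ((x : ↥(Sbarg J lam)) : ↥(algGroup F R J)))))
      (IrrConstituents ↥(algGroup F R J) (xi θ J lam)) := by
  refine bijOn_indFun (S := Sbarg J lam) (L := Lbarg J lam) ?_ (isLinearCharOn_thetaFn θ J lam)
    (thetaFn_conj θ J lam) ?_
  · intro x hx
    have h := Subgroup.mem_subgroupOf.mp hx
    exact Subgroup.mem_subgroupOf.mpr ⟨h.1.1, h.2.1⟩
  · intro g hg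
    obtain ⟨x, hx, hgx, hne⟩ := exists_separating_of_notMem_sbar hJ hθ lam g.2
      (fun h => hg (Subgroup.mem_subgroupOf.mpr h))
    have hxJ : x ∈ algGroup F R J := ⟨lbar_le J lam hx.1, lbar_le J lam hx.2⟩
    refine ⟨⟨x, hxJ⟩, Subgroup.mem_subgroupOf.mpr hx, Subgroup.mem_subgroupOf.mpr hgx, ?_⟩
    rw [thetaFn_eq, thetaFn_eq]
    exact hne

end IterChar
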